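/- Assume 1 < p and α₂ < p. Fix r₀ > 0 and t₀ > 1, set Γ = 2^{α₂(p−1)/(p−α₂)} · G(r₀)/log t₀, and let r₁ > 0 be defined by the equation J(r₁) = E(Γ·log t₀), equivalently G(r₁) = Γ·log t₀. Then r₁ ≤ 2^{α₂(p−1)/(α₁(p−α₂))} · r₀. -/

import Mathlib

open MeasureTheory Set in
/-- The differential inequality `α g(s)/s ≤ g'(s)` makes `s ↦ g(s) s^{-α}` nondecreasing. -/
lemma monotoneOn_mul_rpow_neg {α : ℝ} {g g' : ℝ → ℝ}
    (hgd : ∀ s ∈ Ioi (0:ℝ), HasDerivAt g (g' s) s)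
    (hlow : ∀ s, 0 < s → α * g s / s ≤ g' s) :
    MonotoneOn (fun s => g s * s ^ (-α)) (Ioi 0) := by
  have hd : ∀ s ∈ Ioi (0:ℝ), HasDerivAt (fun s => g s * s ^ (-α))
      (g' s * s ^ (-α) + g s * (-α * s ^ (-α - 1))) s := fun s hs =>
    (hgd s hs).mul (Real.hasDerivAt_rpow_const (Or.inl (ne_of_gt hs)))
  refine monotoneOn_of_hasDerivWithinAt_nonneg (convex_Ioi 0)
    (fun s hs => (hd s hs).continuousAt.continuousWithinAt)
    (fun s hs => (hd s (interior_subset hs)).hasDerivWithinAt) fun s hs => ?_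
  have hs0 : 0 < s := interior_subset hs
  have h1 : s ^ (-α - 1) = s ^ (-α) / s := by rw [Real.rpow_sub hs0, Real.rpow_one]
  have h2 : 0 ≤ (g' s - α * g s / s) * s ^ (-α) :=
    mul_nonneg (sub_nonneg.2 (hlow s hs0)) (Real.rpow_nonneg hs0.le _)
  rw [h1]
  calc (0:ℝ) ≤ (g' s - α * g s / s) * s ^ (-α) := h2
    _ = _ := by ring

open MeasureTheory Set in
/-- Scaling lower bound: `c^α g(s) ≤ g(c s)` for `c ≥ 1`. -/
lemma rpow_mul_le_comp_mul {α : ℝ} {g g' : ℝ → ℝ}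
    (hgd : ∀ s ∈ Ioi (0:ℝ), HasDerivAt g (g' s) s)
    (hlow : ∀ s, 0 < s → α * g s / s ≤ g' s)
    {c s : ℝ} (hc : 1 ≤ c) (hs : 0 < s) : c ^ α * g s ≤ g (c * s) := by
  have hc0 : 0 < c := by linarith
  have h := monotoneOn_mul_rpow_neg hgd hlow (mem_Ioi.2 hs) (mem_Ioi.2 (mul_pos hc0 hs))
    (le_mul_of_one_le_left hs.le hc)
  have hsα : 0 < s ^ α := Real.rpow_pos_of_pos hs _
  have hcα : 0 < c ^ α := Real.rpow_pos_of_pos hc0 _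
  simp only [Real.rpow_neg hs.le, Real.rpow_neg (mul_pos hc0 hs).le,
    Real.mul_rpow hc0.le hs.le, ← div_eq_mul_inv] at h
  rw [div_le_div_iff₀ hsα (by positivity)] at h
  exact le_of_mul_le_mul_right (by linarith) hsα

open MeasureTheory Set in
/-- `g(s)/s` is integrable at the origin. -/
lemma intervalIntegrable_div_self {α : ℝ} (hα : 0 < α) {g g' : ℝ → ℝ}
    (hgd : ∀ s ∈ Ioi (0:ℝ), HasDerivAt g (g' s) s)
    (hgpos : ∀ s, 0 < s → 0 < g s)
    (hlow : ∀ s, 0 < s → α * g s / s ≤ g' s) {r : ℝ} (hr : 0 < r) :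
    IntervalIntegrable (fun s => g s / s) volume 0 r := by
  have hi : IntervalIntegrable (fun s : ℝ => g r * r ^ (-α) * s ^ (α - 1)) volume 0 r :=
    (intervalIntegral.intervalIntegrable_rpow' (by linarith)).const_mul _
  rw [intervalIntegrable_iff_integrableOn_Ioc_of_le hr.le] at hi ⊢
  have hcont : ContinuousOn (fun s => g s / s) (Ioc 0 r) := fun s hs =>
    ((hgd s hs.1).continuousAt.div continuousAt_id hs.1.ne').continuousWithinAt
  refine hi.mono' (hcont.aestronglyMeasurable measurableSet_Ioc) ?_
  filter_upwards [ae_restrict_mem measurableSet_Ioc] with s hs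
  have hs0 : 0 < s := hs.1
  have h := monotoneOn_mul_rpow_neg hgd hlow (mem_Ioi.2 hs0) (mem_Ioi.2 hr) hs.2
  have hsα : 0 < s ^ α := Real.rpow_pos_of_pos hs0 _
  rw [Real.norm_of_nonneg (div_pos (hgpos s hs0) hs0).le, Real.rpow_sub hs0, Real.rpow_one,
    ← mul_div_assoc]
  gcongr
  calc g s = g s * s ^ (-α) * s ^ α := by rw [Real.rpow_neg hs0.le]; field_simp
    _ ≤ _ := by gcongr

open MeasureTheory Set in
/-- The scaling lower bound passes to `G(r) = ∫₀^r g(s)/s ds`. -/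
lemma rpow_mul_integral_div_self_le {α : ℝ} (hα : 0 < α) {g g' : ℝ → ℝ}
    (hgd : ∀ s ∈ Ioi (0:ℝ), HasDerivAt g (g' s) s)
    (hgpos : ∀ s, 0 < s → 0 < g s)
    (hlow : ∀ s, 0 < s → α * g s / s ≤ g' s) {c r : ℝ} (hc : 1 ≤ c) (hr : 0 < r) :
    c ^ α * (∫ s in (0:ℝ)..r, g s / s) ≤ ∫ s in (0:ℝ)..(c * r), g s / s := by
  have hc0 : 0 < c := by linarith
  have hi := intervalIntegrable_div_self hα hgd hgpos hlow (mul_pos hc0 hr)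
  have hsub := intervalIntegral.mul_integral_comp_mul_left (a := 0) (b := r)
    (f := fun s => g s / s) c
  rw [mul_zero] at hsub
  rw [← hsub, ← intervalIntegral.integral_const_mul, ← intervalIntegral.integral_const_mul]
  have hi' : IntervalIntegrable (fun s => g (c * s) / (c * s)) volume 0 r := by
    simpa [hc0.ne'] using hi.comp_mul_left (c := c)
  refine intervalIntegral.integral_mono_on_of_le_Ioo hr.le
    ((intervalIntegrable_div_self hα hgd hgpos hlow hr).const_mul _) (hi'.const_mul _)
    fun s hs => ?_
  have hs0 : 0 < s := hs.1
  calc c ^ α * (g s / s) = c ^ α * g s / s := by ring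
    _ ≤ g (c * s) / s := by gcongr; exact rpow_mul_le_comp_mul hgd hlow hc hs0
    _ = c * (g (c * s) / (c * s)) := by field_simp

open MeasureTheory Set in
/-- `G(r) = ∫₀^r g(s)/s ds` is strictly increasing. -/
lemma integral_div_self_lt {α : ℝ} (hα : 0 < α) {g g' : ℝ → ℝ}
    (hgd : ∀ s ∈ Ioi (0:ℝ), HasDerivAt g (g' s) s)
    (hgpos : ∀ s, 0 < s → 0 < g s)
    (hlow : ∀ s, 0 < s → α * g s / s ≤ g' s) {a b : ℝ} (ha : 0 < a) (hab : a < b) :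
    (∫ s in (0:ℝ)..a, g s / s) < ∫ s in (0:ℝ)..b, g s / s := by
  have hia := intervalIntegrable_div_self hα hgd hgpos hlow ha
  have hib := intervalIntegrable_div_self hα hgd hgpos hlow (ha.trans hab)
  rw [← sub_pos, intervalIntegral.integral_interval_sub_left hib hia]
  refine intervalIntegral.intervalIntegral_pos_of_pos_on (hia.symm.trans hib)
    (fun s hs => ?_) hab
  have hs0 : 0 < s := ha.trans hs.1
  exact div_pos (hgpos s hs0) hs0

/-- With `Γ = 2^{α₂(p−1)/(p−α₂)}·G(r₀)/log t₀` and `r₁ > 0`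
defined by `G(r₁) = Γ·log t₀` (equivalently `J(r₁) = E(Γ·log t₀)`), one has
`r₁ ≤ 2^{α₂(p−1)/(α₁(p−α₂))}·r₀`. -/
theorem initial_support_radius_bound
    (α₁ α₂ : ℝ) (g g' : ℝ → ℝ)
    (hα₁ : 0 < α₁) (hα₁₂ : α₁ ≤ α₂)
    (hgc : ContinuousOn g (Set.Ici 0))
    (hgd : ∀ s ∈ Set.Ioi (0:ℝ), HasDerivAt g (g' s) s)
    (hg'c : ContinuousOn g' (Set.Ioi 0))
    (hg0 : g 0 = 0)
    (hgpos : ∀ s, 0 < s → 0 < g s)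
    (hlow : ∀ s, 0 < s → α₁ * g s / s ≤ g' s)
    (hupp : ∀ s, 0 < s → g' s ≤ α₂ * g s / s)
    (G : ℝ → ℝ) (hG : ∀ r, G r = ∫ s in (0:ℝ)..r, g s / s)
    (p : ℝ) (hp : 1 < p) (hα₂p : α₂ < p)
    (r₀ t₀ : ℝ) (hr₀ : 0 < r₀) (ht₀ : 1 < t₀)
    (Γ : ℝ) (hΓ : Γ = 2 ^ (α₂ * (p-1) / (p - α₂)) * G r₀ / Real.log t₀)
    (r₁ : ℝ) (hr₁ : 0 < r₁) (hr₁def : G r₁ = Γ * Real.log t₀) :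
    r₁ ≤ 2 ^ (α₂ * (p-1) / (α₁ * (p - α₂))) * r₀ := by
  have hlog : Real.log t₀ ≠ 0 := (Real.log_pos ht₀).ne'
  have hpα : 0 < p - α₂ := sub_pos.2 hα₂p
  have hα₂ : 0 < α₂ := hα₁.trans_le hα₁₂
  have hp1 : 0 < p - 1 := sub_pos.2 hp
  set c : ℝ := 2 ^ (α₂ * (p-1) / (α₁ * (p - α₂))) with hc_def
  have hc : 1 ≤ c := Real.one_le_rpow one_le_two (by positivity)
  have hcα : c ^ α₁ = 2 ^ (α₂ * (p-1) / (p - α₂)) := by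
    rw [hc_def, ← Real.rpow_mul zero_le_two]
    congr 1
    field_simp
  rw [hΓ, div_mul_cancel₀ _ hlog, ← hcα, hG, hG] at hr₁def
  by_contra! hlt
  have hle := rpow_mul_integral_div_self_le hα₁ hgd hgpos hlow hc hr₀
  have hlt' := integral_div_self_lt hα₁ hgd hgpos hlow (mul_pos (by linarith) hr₀) hlt
  linarith
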